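/- arXiv:1507.04497 — 5 statements merged into one kernel-verified Lean document; each statement's English description precedes it below -/
import Mathlib

section
/- Let q_tx, q_rc : [0, ∞) → [0, ∞) be continuous, strictly increasing bijections with q_tx(0) = q_rc(0) = 0, let b̄_tx > 0, b̄_rc > 0 satisfy q_tx⁻¹(b̄_tx) ≤ q_rc⁻¹(b̄_rc), and let E_max_tx ≥ b̄_tx and E_max_rc ≥ q_rc(q_tx⁻¹(b̄_tx)). Set v = q_tx⁻¹(b̄_tx) and define sequences by E_1_tx = E_1_rc = 0, P_k = v if (b̄_tx ≤ E_k_tx and q_rc(v) ≤ E_k_rc) and P_k = 0 otherwise, E_{k+1}_tx = min{ E_k_tx − q_tx(P_k) + b̄_tx, E_max_tx }, and E_{k+1}_rc = min{ E_k_rc − q_rc(P_k) + b̄_rc, E_max_rc }. Then P_k = v for all k ≥ 2, and consequently, for every function g : [0, ∞) → ℝ, lim_{K→∞} (1/K) Σ_{k=1}^K g(P_k) = g(v) = g(q_tx⁻¹(b̄_tx)). -/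
open Filter Finset

/-- If `u` converges to `l`, then so do its averages over `1, …, K`. -/
theorem tendsto_sum_Icc_one_div {u : ℕ → ℝ} {l : ℝ} (hu : Tendsto u atTop (nhds l)) :
    Tendsto (fun K : ℕ => (∑ k ∈ Finset.Icc 1 K, u k) / (K : ℝ)) atTop (nhds l) := by
  refine ((tendsto_add_atTop_iff_nat 1).2 hu).cesaro.congr fun K => ?_
  rw [Finset.range_eq_Ico, Finset.sum_Ico_add' u 0 K 1, zero_add,
    Finset.Ico_add_one_right_eq_Icc, inv_mul_eq_div]

/-- If a map of `[0, ∞)` is onto and `f` is a left inverse of it, then `f` preserves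
nonnegativity. -/
theorem leftInverse_nonneg_of_surjOn {q f : ℝ → ℝ} (hq : Set.SurjOn q (Set.Ici 0) (Set.Ici 0))
    (hf : ∀ x ∈ Set.Ici (0 : ℝ), f (q x) = x) {y : ℝ} (hy : 0 ≤ y) : 0 ≤ f y := by
  obtain ⟨x, hx, rfl⟩ := hq hy
  rw [hf x hx]
  exact hx

/-- Achievability of the no-energy-transfer upper bound with deterministic
energy arrivals and finite batteries (Corollary 1 of the paper): under the
stated policy, the transmit power equals `v = qtx⁻¹(b̄tx)` in every slot
`k ≥ 2`, hence the average reward converges to `g v`. -/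
theorem deterministic_achievability_no_ET
    (qtx qrc qtxinv qrcinv : ℝ → ℝ)
    -- qtx is a continuous strictly increasing bijection of [0,∞) with qtx 0 = 0
    (hqtx_cont : ContinuousOn qtx (Set.Ici 0))
    (hqtx_mono : StrictMonoOn qtx (Set.Ici 0))
    (hqtx_maps : Set.MapsTo qtx (Set.Ici 0) (Set.Ici 0))
    (hqtx_surj : Set.SurjOn qtx (Set.Ici 0) (Set.Ici 0))
    (hqtx0 : qtx 0 = 0)
    (hqtxinv_left : ∀ x ∈ Set.Ici (0:ℝ), qtxinv (qtx x) = x)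
    (hqtxinv_right : ∀ y ∈ Set.Ici (0:ℝ), qtx (qtxinv y) = y)
    -- qrc is a continuous strictly increasing bijection of [0,∞) with qrc 0 = 0
    (hqrc_cont : ContinuousOn qrc (Set.Ici 0))
    (hqrc_mono : StrictMonoOn qrc (Set.Ici 0))
    (hqrc_maps : Set.MapsTo qrc (Set.Ici 0) (Set.Ici 0))
    (hqrc_surj : Set.SurjOn qrc (Set.Ici 0) (Set.Ici 0))
    (hqrc0 : qrc 0 = 0)
    (hqrcinv_left : ∀ x ∈ Set.Ici (0:ℝ), qrcinv (qrc x) = x)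
    (hqrcinv_right : ∀ y ∈ Set.Ici (0:ℝ), qrc (qrcinv y) = y)
    -- average arrivals, with the transmitter as the bottleneck
    (bbartx bbarrc : ℝ) (hbtx : 0 < bbartx) (hbrc : 0 < bbarrc)
    (hbottleneck : qtxinv bbartx ≤ qrcinv bbarrc)
    -- battery sizes
    (Emaxtx Emaxrc : ℝ)
    (hEmaxtx : bbartx ≤ Emaxtx)
    (hEmaxrc : qrc (qtxinv bbartx) ≤ Emaxrc)
    -- the policy and battery evolution
    (v : ℝ) (hv : v = qtxinv bbartx)
    (Etx Erc P : ℕ → ℝ)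
    (hEtx1 : Etx 1 = 0) (hErc1 : Erc 1 = 0)
    (hP : ∀ k, 1 ≤ k →
      P k = if bbartx ≤ Etx k ∧ qrc v ≤ Erc k then v else 0)
    (hEtxrec : ∀ k, 1 ≤ k → Etx (k + 1) = min (Etx k - qtx (P k) + bbartx) Emaxtx)
    (hErcrec : ∀ k, 1 ≤ k → Erc (k + 1) = min (Erc k - qrc (P k) + bbarrc) Emaxrc) :
    (∀ k, 2 ≤ k → P k = v) ∧
    (∀ g : ℝ → ℝ,
      Tendsto (fun K => (∑ k ∈ Finset.Icc 1 K, g (P k)) / (K : ℝ)) atTop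
        (nhds (g v)) ∧ g v = g (qtxinv bbartx)) := by
  subst hv
  have hqv : qtx (qtxinv bbartx) = bbartx := hqtxinv_right _ hbtx.le
  have hqrcv : qrc (qtxinv bbartx) ≤ bbarrc := by
    rw [← hqrcinv_right bbarrc hbrc.le]
    exact hqrc_mono.monotoneOn (leftInverse_nonneg_of_surjOn hqtx_surj hqtxinv_left hbtx.le)
      (leftInverse_nonneg_of_surjOn hqrc_surj hqrcinv_left hbrc.le) hbottleneck
  have hP1 : P 1 = 0 := by
    rw [hP 1 le_rfl, if_neg]
    rintro ⟨h, -⟩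
    linarith
  have charged : ∀ k, 2 ≤ k → bbartx ≤ Etx k ∧ qrc (qtxinv bbartx) ≤ Erc k := by
    intro k hk
    induction k, hk using Nat.le_induction with
    | base =>
      rw [hEtxrec 1 le_rfl, hErcrec 1 le_rfl, hP1, hEtx1, hErc1, hqtx0, hqrc0]
      exact ⟨le_min (by linarith) hEmaxtx, le_min (by linarith) hEmaxrc⟩
    | succ k hk ih =>
      have hk1 : 1 ≤ k := by lia
      rw [hEtxrec k hk1, hErcrec k hk1, hP k hk1, if_pos ih, hqv]
      exact ⟨le_min (by linarith) hEmaxtx, le_min (by linarith) hEmaxrc⟩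
  have hPv : ∀ k, 2 ≤ k → P k = qtxinv bbartx := fun k hk => by
    rw [hP k (by lia), if_pos (charged k hk)]
  refine ⟨hPv, fun g => ⟨tendsto_sum_Icc_one_div (tendsto_const_nhds.congr' ?_), rfl⟩⟩
  filter_upwards [eventually_ge_atTop 2] with k hk
  rw [hPv k hk]
end

section
/- Let q_tx, q_rc : [0, ∞) → [0, ∞) be continuous, strictly increasing bijections with q_tx(0) = q_rc(0) = 0, let b̄_tx > 0, b̄_rc > 0, β ∈ [0, 1], and define c̄_tx(ξ) = b̄_tx + β b̄_rc (1 − ξ) and c̄_rc(ξ) = b̄_rc ξ. Let ξ* ∈ (0, 1] be such that either (ξ* = 1 and q_rc⁻¹(b̄_rc) ≤ q_tx⁻¹(b̄_tx)) or (ξ* < 1 and q_tx⁻¹(c̄_tx(ξ*)) = q_rc⁻¹(c̄_rc(ξ*))). Set v = q_rc⁻¹(c̄_rc(ξ*)), assume E_max_tx ≥ q_tx(v) and E_max_rc ≥ b̄_rc, and define sequences by E_1_tx = E_1_rc = 0, P_k = v if (c̄_rc(ξ*) ≤ E_k_rc and q_tx(v) ≤ E_k_tx) and P_k = 0 otherwise,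 D_k = b̄_rc − q_rc(P_k) if E_k_rc ≥ b̄_rc and D_k = 0 otherwise, E_{k+1}_tx = min{ E_k_tx − q_tx(P_k) + β D_k + b̄_tx, E_max_tx }, and E_{k+1}_rc = min{ E_k_rc − q_rc(P_k) − D_k + b̄_rc, E_max_rc }. Then P_k = v for all k ≥ 3, and consequently, for every function g : [0, ∞) → ℝ, lim_{K→∞} (1/K) Σ_{k=1}^K g(P_k) = g(v) = g(q_rc⁻¹(c̄_rc(ξ*))). -/
open Filter Finset

/-- A left inverse on `[0, ∞)` of a surjection of `[0, ∞)` is nonnegative on `[0, ∞)`. -/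
theorem nonneg_of_leftInverse_of_surjOn {q r : ℝ → ℝ}
    (hsurj : Set.SurjOn q (Set.Ici 0) (Set.Ici 0))
    (hleft : ∀ x ∈ Set.Ici (0 : ℝ), r (q x) = x) {y : ℝ} (hy : 0 ≤ y) : 0 ≤ r y := by
  obtain ⟨x, hx, rfl⟩ := hsurj hy
  rw [hleft x hx]
  exact hx

/-- Cesàro averages over `1, …, K` of an eventually constant sequence converge to the constant. -/
theorem tendsto_average_Icc_of_eventually_eq {f : ℕ → ℝ} {a : ℝ} {N : ℕ}
    (hf : ∀ k, N ≤ k → f k = a) :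
    Tendsto (fun K => (∑ k ∈ Finset.Icc 1 K, f k) / (K : ℝ)) atTop (nhds a) := by
  have hlim : Tendsto (fun k => f (k + 1)) atTop (nhds a) :=
    tendsto_const_nhds.congr' <| by
      filter_upwards [eventually_ge_atTop N] with k hk
      exact (hf (k + 1) (by omega)).symm
  refine hlim.cesaro.congr fun K => ?_
  have hsum : ∑ k ∈ Finset.Icc 1 K, f k = ∑ k ∈ Finset.range K, f (k + 1) := by
    induction K with
    | zero => simp
    | succ K ih => rw [Finset.sum_Icc_succ_top (by omega), ih, Finset.sum_range_succ]
  rw [hsum, div_eq_inv_mul]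

/-- Achievability of the energy-transfer upper bound with deterministic
energy arrivals and finite batteries (Corollary 3 of the paper): under the
stated policy, the transmit power equals `v = qrc⁻¹(c̄rc ξ*)` in every slot
`k ≥ 3`, hence the average reward converges to `g v`. -/
theorem deterministic_achievability_ET
    (qtx qrc qtxinv qrcinv : ℝ → ℝ)
    -- qtx is a continuous strictly increasing bijection of [0,∞) with qtx 0 = 0
    (hqtx_cont : ContinuousOn qtx (Set.Ici 0))
    (hqtx_mono : StrictMonoOn qtx (Set.Ici 0))
    (hqtx_maps : Set.MapsTo qtx (Set.Ici 0) (Set.Ici 0))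
    (hqtx_surj : Set.SurjOn qtx (Set.Ici 0) (Set.Ici 0))
    (hqtx0 : qtx 0 = 0)
    (hqtxinv_left : ∀ x ∈ Set.Ici (0:ℝ), qtxinv (qtx x) = x)
    (hqtxinv_right : ∀ y ∈ Set.Ici (0:ℝ), qtx (qtxinv y) = y)
    -- qrc is a continuous strictly increasing bijection of [0,∞) with qrc 0 = 0
    (hqrc_cont : ContinuousOn qrc (Set.Ici 0))
    (hqrc_mono : StrictMonoOn qrc (Set.Ici 0))
    (hqrc_maps : Set.MapsTo qrc (Set.Ici 0) (Set.Ici 0))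
    (hqrc_surj : Set.SurjOn qrc (Set.Ici 0) (Set.Ici 0))
    (hqrc0 : qrc 0 = 0)
    (hqrcinv_left : ∀ x ∈ Set.Ici (0:ℝ), qrcinv (qrc x) = x)
    (hqrcinv_right : ∀ y ∈ Set.Ici (0:ℝ), qrc (qrcinv y) = y)
    -- average arrivals and transfer efficiency
    (bbartx bbarrc β : ℝ) (hbtx : 0 < bbartx) (hbrc : 0 < bbarrc)
    (hβ : β ∈ Set.Icc (0:ℝ) 1)
    -- the balancing fraction ξ* (with c̄tx ξ = b̄tx + β b̄rc (1-ξ), c̄rc ξ = b̄rc ξ)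
    (ξstar : ℝ) (hξ : ξstar ∈ Set.Ioc (0:ℝ) 1)
    (hξchar :
      (ξstar = 1 ∧ qrcinv bbarrc ≤ qtxinv bbartx) ∨
      (ξstar < 1 ∧
        qtxinv (bbartx + β * bbarrc * (1 - ξstar)) = qrcinv (bbarrc * ξstar)))
    -- the fixed power v = qrc⁻¹(c̄rc ξ*)
    (v : ℝ) (hv : v = qrcinv (bbarrc * ξstar))
    -- battery sizes
    (Emaxtx Emaxrc : ℝ)
    (hEmaxtx : qtx v ≤ Emaxtx)
    (hEmaxrc : bbarrc ≤ Emaxrc)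
    -- the policy and battery evolution
    (Etx Erc P D : ℕ → ℝ)
    (hEtx1 : Etx 1 = 0) (hErc1 : Erc 1 = 0)
    (hP : ∀ k, 1 ≤ k →
      P k = if bbarrc * ξstar ≤ Erc k ∧ qtx v ≤ Etx k then v else 0)
    (hD : ∀ k, 1 ≤ k →
      D k = if bbarrc ≤ Erc k then bbarrc - qrc (P k) else 0)
    (hEtxrec : ∀ k, 1 ≤ k →
      Etx (k + 1) = min (Etx k - qtx (P k) + β * D k + bbartx) Emaxtx)
    (hErcrec : ∀ k, 1 ≤ k →
      Erc (k + 1) = min (Erc k - qrc (P k) - D k + bbarrc) Emaxrc) :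
    (∀ k, 3 ≤ k → P k = v) ∧
    (∀ g : ℝ → ℝ,
      Tendsto (fun K => (∑ k ∈ Finset.Icc 1 K, g (P k)) / (K : ℝ)) atTop
        (nhds (g v)) ∧ g v = g (qrcinv (bbarrc * ξstar))) := by
  obtain ⟨hξ0, hξ1⟩ := hξ
  obtain ⟨hβ0, -⟩ := hβ
  have hc0 : 0 < bbarrc * ξstar := mul_pos hbrc hξ0
  have hcle : bbarrc * ξstar ≤ bbarrc := mul_le_of_le_one_right hbrc.le hξ1
  have hv0 : 0 ≤ v := hv ▸ nonneg_of_leftInverse_of_surjOn hqrc_surj hqrcinv_left hc0.le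
  have hqv : qrc v = bbarrc * ξstar := hv ▸ hqrcinv_right _ hc0.le
  have hT0 : 0 ≤ qtx v := hqtx_maps hv0
  have hTle : qtx v ≤ bbartx + β * (bbarrc - bbarrc * ξstar) := by
    rcases hξchar with ⟨h1, hle⟩ | ⟨-, heq⟩
    · have hmono := hqtx_mono.monotoneOn hv0
        (nonneg_of_leftInverse_of_surjOn hqtx_surj hqtxinv_left hbtx.le)
        (by rw [hv, h1, mul_one]; exact hle)
      rw [hqtxinv_right _ hbtx.le] at hmono
      simpa [h1] using hmono
    · have hy : 0 ≤ bbartx + β * bbarrc * (1 - ξstar) := by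
        have := mul_nonneg (mul_nonneg hβ0 hbrc.le) (sub_nonneg.2 hξ1)
        linarith
      rw [hv, ← heq, hqtxinv_right _ hy]
      exact le_of_eq (by ring)
  have hP1 : P 1 = 0 := by
    rw [hP 1 le_rfl, hErc1, if_neg fun h => hc0.not_ge h.1]
  have hD1 : D 1 = 0 := by
    rw [hD 1 le_rfl, hErc1, if_neg hbrc.not_ge]
  have hErc : ∀ k, 2 ≤ k → Erc k = bbarrc := by
    intro k hk
    induction k, hk using Nat.le_induction with
    | base =>
      rw [hErcrec 1 le_rfl, hErc1, hP1, hD1, hqrc0]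
      simpa using hEmaxrc
    | succ k hk ih =>
      rw [hErcrec k (by omega), hD k (by omega), ih, if_pos le_rfl]
      simpa using hEmaxrc
  have hD_eq : ∀ k, 2 ≤ k → D k = bbarrc - qrc (P k) := fun k hk => by
    rw [hD k (by omega), if_pos (hErc k hk).ge]
  have hP_eq : ∀ k, 2 ≤ k → qtx v ≤ Etx k → P k = v := fun k hk hE => by
    rw [hP k (by omega), if_pos ⟨(hErc k hk).symm ▸ hcle, hE⟩]
  have hstep : ∀ k, 2 ≤ k → qtx v ≤ Etx k → qtx v ≤ Etx (k + 1) := fun k hk hE => by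
    rw [hEtxrec k (by omega), hD_eq k hk, hP_eq k hk hE, hqv]
    exact le_min (by linarith) hEmaxtx
  have hEtx2 : 0 ≤ Etx 2 := by
    rw [hEtxrec 1 le_rfl, hEtx1, hP1, hD1, hqtx0]
    exact le_min (by linarith) (hT0.trans hEmaxtx)
  have hEtx3 : qtx v ≤ Etx 3 := by
    by_cases hE : qtx v ≤ Etx 2
    · exact hstep 2 le_rfl hE
    · have hP2 : P 2 = 0 := by rw [hP 2 (by omega), if_neg fun h => hE h.2]
      rw [hEtxrec 2 (by omega), hD_eq 2 le_rfl, hP2, hqtx0, hqrc0]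
      have := mul_nonneg hβ0 hc0.le
      exact le_min (by linarith) hEmaxtx
  have hEtx : ∀ k, 3 ≤ k → qtx v ≤ Etx k := by
    intro k hk
    induction k, hk using Nat.le_induction with
    | base => exact hEtx3
    | succ k hk ih => exact hstep k (by omega) ih
  have hPv : ∀ k, 3 ≤ k → P k = v := fun k hk => hP_eq k (by omega) (hEtx k hk)
  exact ⟨hPv, fun g => ⟨tendsto_average_Icc_of_eventually_eq fun k hk => by rw [hPv k hk],
    by rw [hv]⟩⟩
end

section
/- Let q_tx, q_rc : [0, ∞) → [0, ∞) be continuous, strictly increasing bijections with q_tx(0) = q_rc(0) = 0, let g : [0, ∞) → ℝ be strictly increasing, let b̄_tx > 0, b̄_rc > 0, β ∈ (0, 1], and define c̄_tx(ξ) = b̄_tx + β b̄_rc (1 − ξ) and c̄_rc(ξ) = b̄_rc ξ. Let ξ* ∈ (0, 1] be the unique value such that either (ξ* = 1 and q_rc⁻¹(b̄_rc) ≤ q_tx⁻¹(b̄_tx)) or (ξ* < 1 and q_tx⁻¹(c̄_tx(ξ*)) = q_rc⁻¹(c̄_rc(ξ*))). Define G_noET = g( min{ q_tx⁻¹(b̄_tx),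 q_rc⁻¹(b̄_rc) } ) and G_ET = g( q_rc⁻¹( c̄_rc(ξ*) ) ). Then G_ET > G_noET if and only if ξ* < 1. -/
/-- A left inverse on `s` of a strictly increasing map from `s` onto `t` is strictly increasing
on `t`. -/
lemma StrictMonoOn.strictMonoOn_of_leftInvOn {α β : Type*} [LinearOrder α] [Preorder β]
    {f : α → β} {h : β → α} {s : Set α} {t : Set β} (hf : StrictMonoOn f s)
    (hsurj : Set.SurjOn f s t) (hh : Set.LeftInvOn h f s) : StrictMonoOn h t := by
  intro a ha b hb hab
  obtain ⟨x, hx, rfl⟩ := hsurj ha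
  obtain ⟨y, hy, rfl⟩ := hsurj hb
  rw [hh hx, hh hy]
  exact (hf.lt_iff_lt hx hy).1 hab

/-- Proposition 1 of the paper: when the auxiliary functions coincide with
the true consumption functions, energy transfer strictly improves the
performance upper bound if and only if the balancing fraction ξ* is
strictly less than 1. -/
theorem ET_improves_iff
    (qtx qrc qtxinv qrcinv g : ℝ → ℝ)
    -- qtx is a continuous strictly increasing bijection of [0,∞) with qtx 0 = 0
    (hqtx_cont : ContinuousOn qtx (Set.Ici 0))
    (hqtx_mono : StrictMonoOn qtx (Set.Ici 0))
    (hqtx_maps : Set.MapsTo qtx (Set.Ici 0) (Set.Ici 0))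
    (hqtx_surj : Set.SurjOn qtx (Set.Ici 0) (Set.Ici 0))
    (hqtx0 : qtx 0 = 0)
    (hqtxinv_left : ∀ x ∈ Set.Ici (0:ℝ), qtxinv (qtx x) = x)
    (hqtxinv_right : ∀ y ∈ Set.Ici (0:ℝ), qtx (qtxinv y) = y)
    -- qrc is a continuous strictly increasing bijection of [0,∞) with qrc 0 = 0
    (hqrc_cont : ContinuousOn qrc (Set.Ici 0))
    (hqrc_mono : StrictMonoOn qrc (Set.Ici 0))
    (hqrc_maps : Set.MapsTo qrc (Set.Ici 0) (Set.Ici 0))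
    (hqrc_surj : Set.SurjOn qrc (Set.Ici 0) (Set.Ici 0))
    (hqrc0 : qrc 0 = 0)
    (hqrcinv_left : ∀ x ∈ Set.Ici (0:ℝ), qrcinv (qrc x) = x)
    (hqrcinv_right : ∀ y ∈ Set.Ici (0:ℝ), qrc (qrcinv y) = y)
    -- g is strictly increasing on [0,∞)
    (hg_mono : StrictMonoOn g (Set.Ici 0))
    -- average arrivals and transfer efficiency
    (bbartx bbarrc β : ℝ) (hbtx : 0 < bbartx) (hbrc : 0 < bbarrc)
    (hβ : β ∈ Set.Ioc (0:ℝ) 1)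
    -- the balancing fraction ξ* (with c̄tx ξ = b̄tx + β b̄rc (1-ξ), c̄rc ξ = b̄rc ξ)
    (ξstar : ℝ) (hξ : ξstar ∈ Set.Ioc (0:ℝ) 1)
    (hξchar :
      (ξstar = 1 ∧ qrcinv bbarrc ≤ qtxinv bbartx) ∨
      (ξstar < 1 ∧
        qtxinv (bbartx + β * bbarrc * (1 - ξstar)) = qrcinv (bbarrc * ξstar)))
    (hξuniq : ∀ ξ' ∈ Set.Ioc (0:ℝ) 1,
      ((ξ' = 1 ∧ qrcinv bbarrc ≤ qtxinv bbartx) ∨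
       (ξ' < 1 ∧
         qtxinv (bbartx + β * bbarrc * (1 - ξ')) = qrcinv (bbarrc * ξ'))) →
      ξ' = ξstar)
    -- the two upper bounds
    (GnoET GET : ℝ)
    (hGnoET : GnoET = g (min (qtxinv bbartx) (qrcinv bbarrc)))
    (hGET : GET = g (qrcinv (bbarrc * ξstar))) :
    GnoET < GET ↔ ξstar < 1 := by
  have htx_mono : StrictMonoOn qtxinv (Set.Ici 0) :=
    hqtx_mono.strictMonoOn_of_leftInvOn hqtx_surj hqtxinv_left
  have htx_nonneg : Set.MapsTo qtxinv (Set.Ici 0) (Set.Ici 0) :=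
    Set.LeftInvOn.mapsTo hqtxinv_left hqtx_surj
  have hrc_nonneg : Set.MapsTo qrcinv (Set.Ici 0) (Set.Ici 0) :=
    Set.LeftInvOn.mapsTo hqrcinv_left hqrc_surj
  subst hGnoET hGET
  rcases hξchar with ⟨rfl, hle⟩ | ⟨hlt, heq⟩
  · simp [min_eq_right hle]
  · refine iff_of_true ?_ hlt
    have htransfer : 0 < β * bbarrc * (1 - ξstar) :=
      mul_pos (mul_pos hβ.1 hbrc) (sub_pos.2 hlt)
    have hbtx_mem : bbartx ∈ Set.Ici (0 : ℝ) := hbtx.le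
    have hc_mem : bbartx + β * bbarrc * (1 - ξstar) ∈ Set.Ici (0 : ℝ) :=
      (add_pos hbtx htransfer).le
    rw [← heq]
    refine hg_mono ?_ (htx_nonneg hc_mem) ?_
    · exact Set.mem_Ici.2 (le_min (htx_nonneg hbtx_mem) (hrc_nonneg hbrc.le))
    · exact (min_le_left _ _).trans_lt
        (htx_mono hbtx_mem hc_mem (lt_add_of_pos_right _ htransfer))
end

section
/- Let q_tx, q_rc : [0, ∞) → [0, ∞) be continuous, strictly increasing bijections with q_tx(0) = q_rc(0) = 0, let b̄_tx > 0, b̄_rc > 0, β ∈ [0, 1], and define c̄_tx(ξ) = b̄_tx + β b̄_rc (1 − ξ) and c̄_rc(ξ) = b̄_rc ξ. Let ξ* ∈ (0, 1] be the unique value such that either (ξ* = 1 and q_rc⁻¹(b̄_rc) ≤ q_tx⁻¹(b̄_tx)) or (ξ* < 1 and q_tx⁻¹(c̄_tx(ξ*)) = q_rc⁻¹(c̄_rc(ξ*))). Then ξ* < 1 if and only if q_tx⁻¹(b̄_tx) < q_rc⁻¹(b̄_rc). -/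
/-- A left inverse, on the image, of a strictly increasing map is strictly increasing there. -/
theorem StrictMonoOn.strictMonoOn_leftInvOn {α β : Type*} [LinearOrder α] [Preorder β]
    {f : α → β} {g : β → α} {s : Set α} {t : Set β} (hf : StrictMonoOn f s)
    (hsurj : Set.SurjOn f s t) (hg : Set.LeftInvOn g f s) : StrictMonoOn g t := by
  intro y hy z hz hyz
  obtain ⟨a, ha, rfl⟩ := hsurj hy
  obtain ⟨b, hb, rfl⟩ := hsurj hz
  rw [hg ha, hg hb]
  exact (hf.lt_iff_lt ha hb).1 hyz

/-- The balancing fraction ξ* of the energy-transfer upper bound is strictly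
less than 1 if and only if the receiver's harvesting rate corresponds to a
larger transmission power than the transmitter's. -/
theorem xi_star_lt_one_iff
    (qtx qrc qtxinv qrcinv : ℝ → ℝ)
    -- qtx is a continuous strictly increasing bijection of [0,∞) with qtx 0 = 0
    (hqtx_cont : ContinuousOn qtx (Set.Ici 0))
    (hqtx_mono : StrictMonoOn qtx (Set.Ici 0))
    (hqtx_maps : Set.MapsTo qtx (Set.Ici 0) (Set.Ici 0))
    (hqtx_surj : Set.SurjOn qtx (Set.Ici 0) (Set.Ici 0))
    (hqtx0 : qtx 0 = 0)
    (hqtxinv_left : ∀ x ∈ Set.Ici (0:ℝ), qtxinv (qtx x) = x)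
    (hqtxinv_right : ∀ y ∈ Set.Ici (0:ℝ), qtx (qtxinv y) = y)
    -- qrc is a continuous strictly increasing bijection of [0,∞) with qrc 0 = 0
    (hqrc_cont : ContinuousOn qrc (Set.Ici 0))
    (hqrc_mono : StrictMonoOn qrc (Set.Ici 0))
    (hqrc_maps : Set.MapsTo qrc (Set.Ici 0) (Set.Ici 0))
    (hqrc_surj : Set.SurjOn qrc (Set.Ici 0) (Set.Ici 0))
    (hqrc0 : qrc 0 = 0)
    (hqrcinv_left : ∀ x ∈ Set.Ici (0:ℝ), qrcinv (qrc x) = x)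
    (hqrcinv_right : ∀ y ∈ Set.Ici (0:ℝ), qrc (qrcinv y) = y)
    -- average arrivals and transfer efficiency
    (bbartx bbarrc β : ℝ) (hbtx : 0 < bbartx) (hbrc : 0 < bbarrc)
    (hβ : β ∈ Set.Icc (0:ℝ) 1)
    -- the balancing fraction ξ* (with c̄tx ξ = b̄tx + β b̄rc (1-ξ), c̄rc ξ = b̄rc ξ)
    (ξstar : ℝ) (hξ : ξstar ∈ Set.Ioc (0:ℝ) 1)
    (hξchar :
      (ξstar = 1 ∧ qrcinv bbarrc ≤ qtxinv bbartx) ∨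
      (ξstar < 1 ∧
        qtxinv (bbartx + β * bbarrc * (1 - ξstar)) = qrcinv (bbarrc * ξstar)))
    (hξuniq : ∀ ξ' ∈ Set.Ioc (0:ℝ) 1,
      ((ξ' = 1 ∧ qrcinv bbarrc ≤ qtxinv bbartx) ∨
       (ξ' < 1 ∧
         qtxinv (bbartx + β * bbarrc * (1 - ξ')) = qrcinv (bbarrc * ξ'))) →
      ξ' = ξstar)
    :
    ξstar < 1 ↔ qtxinv bbartx < qrcinv bbarrc := by
  have htx : StrictMonoOn qtxinv (Set.Ici 0) :=
    hqtx_mono.strictMonoOn_leftInvOn hqtx_surj hqtxinv_left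
  have hrc : StrictMonoOn qrcinv (Set.Ici 0) :=
    hqrc_mono.strictMonoOn_leftInvOn hqrc_surj hqrcinv_left
  rcases hξchar with ⟨rfl, hle⟩ | ⟨hlt, heq⟩
  · exact iff_of_false (lt_irrefl _) hle.not_gt
  · refine iff_of_true hlt ?_
    have htransfer : 0 ≤ β * bbarrc * (1 - ξstar) :=
      mul_nonneg (mul_nonneg hβ.1 hbrc.le) (sub_nonneg.2 hξ.2)
    calc qtxinv bbartx ≤ qtxinv (bbartx + β * bbarrc * (1 - ξstar)) :=
          htx.monotoneOn hbtx.le (add_nonneg hbtx.le htransfer)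
            (le_add_of_nonneg_right htransfer)
      _ = qrcinv (bbarrc * ξstar) := heq
      _ < qrcinv bbarrc :=
          hrc (mul_nonneg hbrc.le hξ.1.le) hbrc.le (mul_lt_of_lt_one_right hbrc hlt)
end

section
/- Let q_tx, q_rc : [0, ∞) → [0, ∞) be continuous, strictly increasing bijections with q_tx(0) = q_rc(0) = 0, let b̄_tx > 0, b̄_rc > 0, β ∈ [0, 1], define c̄_tx(ξ) = b̄_tx + β b̄_rc (1 − ξ) and c̄_rc(ξ) = b̄_rc ξ, and let ξ* ∈ (0, 1] satisfy either (ξ* = 1 and q_rc⁻¹(b̄_rc) ≤ q_tx⁻¹(b̄_tx)) or (ξ* < 1 and q_tx⁻¹(c̄_tx(ξ*)) = q_rc⁻¹(c̄_rc(ξ*))). Let (B_k_tx)_{k≥1}, (B_k_rc)_{k≥1} be nonnegative sequences with (1/K) Σ_{k=1}^K B_k_tx → b̄_tx and (1/K) Σ_{k=1}^K B_k_rc → b̄_rc as K → ∞. Then for every ε ∈ (0, b̄_rc ξ*) there exists an integer N ≥ 1 such that the sequences given by P_k = 0, D_k = 0 for k ≤ N and P_k = q_rc⁻¹(b̄_rc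 ξ* − ε), D_k = b̄_rc (1 − ξ*) for k > N are feasible, i.e. for all k ≥ 1: Σ_{j=1}^k ( q_rc(P_j) + D_j ) ≤ Σ_{j=1}^{k−1} B_j_rc and Σ_{j=1}^k q_tx(P_j) ≤ Σ_{j=1}^{k−1} ( B_j_tx + β D_j ). Consequently, for every nondecreasing g : [0, ∞) → ℝ and every such ε, there is a feasible pair of sequences whose liminf average reward liminf_{K→∞} (1/K) Σ_{k=1}^K g(P_k) is at least g(q_rc⁻¹(b̄_rc ξ* − ε)). -/
open Filter Finset

lemma sum_Icc_one_ite_le (N : ℕ) (c : ℝ) (k : ℕ) :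
    ∑ j ∈ Finset.Icc 1 k, (if j ≤ N then 0 else c) = ((k - N : ℕ) : ℝ) * c := by
  induction k with
  | zero => simp
  | succ k ih =>
    rw [Finset.sum_Icc_succ_top (by omega), ih]
    split_ifs with h
    · rw [Nat.sub_eq_zero_of_le h, Nat.sub_eq_zero_of_le (by omega : k ≤ N)]
      simp
    · rw [Nat.succ_sub (by omega : N ≤ k)]
      push_cast
      ring

lemma eventually_mul_le_sum_of_tendsto_average {B : ℕ → ℝ} {b c : ℝ}
    (hB : Tendsto (fun K => (∑ k ∈ Finset.Icc 1 K, B k) / (K : ℝ)) atTop (nhds b))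
    (hc : c < b) :
    ∀ᶠ K : ℕ in atTop, c * K ≤ ∑ k ∈ Finset.Icc 1 K, B k := by
  filter_upwards [hB.eventually_const_lt hc, eventually_gt_atTop 0] with K hK hpos
  exact ((lt_div_iff₀ (Nat.cast_pos.mpr hpos)).mp hK).le

lemma tendsto_average_of_eventually_const {u : ℕ → ℝ} {c : ℝ} {N : ℕ}
    (hu : ∀ k, N < k → u k = c) :
    Tendsto (fun K => (∑ k ∈ Finset.Icc 1 K, u k) / (K : ℝ)) atTop (nhds c) := by
  have hlim : Tendsto (fun i => u (i + 1)) atTop (nhds c) :=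
    tendsto_const_nhds.congr' <| by
      filter_upwards [eventually_ge_atTop N] with i hi
      exact (hu _ (by omega)).symm
  refine hlim.cesaro.congr fun K => ?_
  have hsum : ∑ i ∈ Finset.range K, u (i + 1) = ∑ k ∈ Finset.Icc 1 K, u k := by
    induction K with
    | zero => simp
    | succ K ih => rw [Finset.sum_range_succ, ih, Finset.sum_Icc_succ_top (by omega)]
  rw [hsum, div_eq_inv_mul]

/-- A left inverse on `[0, ∞)` of a surjection of `[0, ∞)` takes nonnegative values there. -/
lemma inv_nonneg_of_surjOn {q qinv : ℝ → ℝ} (hsurj : Set.SurjOn q (Set.Ici 0) (Set.Ici 0))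
    (hleft : ∀ x ∈ Set.Ici (0:ℝ), qinv (q x) = x) {y : ℝ} (hy : 0 ≤ y) : 0 ≤ qinv y := by
  obtain ⟨x, hx, rfl⟩ := hsurj hy
  rw [hleft x hx]
  exact hx

lemma eventually_save_length_receiver {B : ℕ → ℝ} {b a : ℝ} (hB_nonneg : ∀ k, 0 ≤ B k)
    (hB : Tendsto (fun K => (∑ k ∈ Finset.Icc 1 K, B k) / (K : ℝ)) atTop (nhds b))
    (ha : 0 ≤ a) (hab : a < b) :
    ∀ᶠ N : ℕ in atTop, ∀ k : ℕ,
      ((k - N : ℕ) : ℝ) * a ≤ ∑ j ∈ Finset.Icc 1 (k - 1), B j := by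
  obtain ⟨M, hM⟩ := eventually_atTop.mp (eventually_mul_le_sum_of_tendsto_average hB hab)
  filter_upwards [eventually_ge_atTop M, eventually_ge_atTop 1] with N hNM hN k
  rcases le_or_gt k N with hk | hk
  · rw [Nat.sub_eq_zero_of_le hk]
    simpa using Finset.sum_nonneg fun j _ => hB_nonneg j
  · refine le_trans ?_ (hM (k - 1) (by omega))
    rw [mul_comm]
    gcongr

lemma eventually_save_length_transmitter {B : ℕ → ℝ} {b d t : ℝ} (hB_nonneg : ∀ k, 0 ≤ B k)
    (hB : Tendsto (fun K => (∑ k ∈ Finset.Icc 1 K, B k) / (K : ℝ)) atTop (nhds b))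
    (hb : 0 < b) (htd : t < b + d) :
    ∀ᶠ N : ℕ in atTop, ∀ k : ℕ,
      ((k - N : ℕ) : ℝ) * t
        ≤ ∑ j ∈ Finset.Icc 1 (k - 1), B j + ((k - 1 - N : ℕ) : ℝ) * d := by
  obtain ⟨c, hc, hcb⟩ : ∃ c, max 0 (t - d) < c ∧ c < b :=
    exists_between (max_lt hb (by linarith))
  obtain ⟨hc0, hct⟩ := max_lt_iff.mp hc
  obtain ⟨M, hM⟩ := eventually_atTop.mp (eventually_mul_le_sum_of_tendsto_average hB hcb)
  filter_upwards [eventually_ge_atTop M,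
    tendsto_natCast_atTop_atTop.eventually_ge_atTop (t / c)] with N hNM hNt k
  rw [div_le_iff₀ hc0] at hNt
  rcases le_or_gt k N with hk | hk
  · rw [Nat.sub_eq_zero_of_le hk, Nat.sub_eq_zero_of_le (by omega : k - 1 ≤ N)]
    simpa using Finset.sum_nonneg fun j _ => hB_nonneg j
  · obtain ⟨m, rfl⟩ : ∃ m, k = N + m + 1 := ⟨k - N - 1, by omega⟩
    have hS := hM (N + m) (by omega)
    rw [show N + m + 1 - N = m + 1 by omega, show N + m + 1 - 1 = N + m by omega,
      show N + m - N = m by omega]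
    push_cast at hS ⊢
    nlinarith [mul_le_mul_of_nonneg_left hct.le (Nat.cast_nonneg (α := ℝ) m)]

/-- Save-and-transmit achievability with infinite batteries and energy
transfer (Corollary 4 of the paper): for every `ε ∈ (0, b̄rc ξ*)` the policy
that stays silent for the first `N` slots and then uses the constant power
`qrc⁻¹(b̄rc ξ* − ε)` while the receiver transfers the constant amount
`b̄rc (1 − ξ*)` is feasible for some `N`, and hence a liminf average reward
of at least `g (qrc⁻¹(b̄rc ξ* − ε))` is achievable. -/
theorem save_and_transmit_ET
    (qtx qrc qtxinv qrcinv : ℝ → ℝ)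
    -- qtx is a continuous strictly increasing bijection of [0,∞) with qtx 0 = 0
    (hqtx_cont : ContinuousOn qtx (Set.Ici 0))
    (hqtx_mono : StrictMonoOn qtx (Set.Ici 0))
    (hqtx_maps : Set.MapsTo qtx (Set.Ici 0) (Set.Ici 0))
    (hqtx_surj : Set.SurjOn qtx (Set.Ici 0) (Set.Ici 0))
    (hqtx0 : qtx 0 = 0)
    (hqtxinv_left : ∀ x ∈ Set.Ici (0:ℝ), qtxinv (qtx x) = x)
    (hqtxinv_right : ∀ y ∈ Set.Ici (0:ℝ), qtx (qtxinv y) = y)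
    -- qrc is a continuous strictly increasing bijection of [0,∞) with qrc 0 = 0
    (hqrc_cont : ContinuousOn qrc (Set.Ici 0))
    (hqrc_mono : StrictMonoOn qrc (Set.Ici 0))
    (hqrc_maps : Set.MapsTo qrc (Set.Ici 0) (Set.Ici 0))
    (hqrc_surj : Set.SurjOn qrc (Set.Ici 0) (Set.Ici 0))
    (hqrc0 : qrc 0 = 0)
    (hqrcinv_left : ∀ x ∈ Set.Ici (0:ℝ), qrcinv (qrc x) = x)
    (hqrcinv_right : ∀ y ∈ Set.Ici (0:ℝ), qrc (qrcinv y) = y)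
    -- average arrivals and transfer efficiency
    (bbartx bbarrc β : ℝ) (hbtx : 0 < bbartx) (hbrc : 0 < bbarrc)
    (hβ : β ∈ Set.Icc (0:ℝ) 1)
    -- the balancing fraction ξ* (with c̄tx ξ = b̄tx + β b̄rc (1-ξ), c̄rc ξ = b̄rc ξ)
    (ξstar : ℝ) (hξ : ξstar ∈ Set.Ioc (0:ℝ) 1)
    (hξchar :
      (ξstar = 1 ∧ qrcinv bbarrc ≤ qtxinv bbartx) ∨
      (ξstar < 1 ∧
        qtxinv (bbartx + β * bbarrc * (1 - ξstar)) = qrcinv (bbarrc * ξstar)))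
    -- the energy arrival sequences and their Cesàro means
    (Btx Brc : ℕ → ℝ)
    (hBtx_nonneg : ∀ k, 0 ≤ Btx k) (hBrc_nonneg : ∀ k, 0 ≤ Brc k)
    (hBtx_mean :
      Tendsto (fun K => (∑ k ∈ Finset.Icc 1 K, Btx k) / (K : ℝ)) atTop (nhds bbartx))
    (hBrc_mean :
      Tendsto (fun K => (∑ k ∈ Finset.Icc 1 K, Brc k) / (K : ℝ)) atTop (nhds bbarrc)) :
    (∀ ε ∈ Set.Ioo (0:ℝ) (bbarrc * ξstar), ∃ N : ℕ, 1 ≤ N ∧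
      ∀ k : ℕ, 1 ≤ k →
        (∑ j ∈ Finset.Icc 1 k,
            (qrc (if j ≤ N then 0 else qrcinv (bbarrc * ξstar - ε)) +
              (if j ≤ N then 0 else bbarrc * (1 - ξstar))))
          ≤ ∑ j ∈ Finset.Icc 1 (k - 1), Brc j ∧
        (∑ j ∈ Finset.Icc 1 k, qtx (if j ≤ N then 0 else qrcinv (bbarrc * ξstar - ε)))
          ≤ ∑ j ∈ Finset.Icc 1 (k - 1),
              (Btx j + β * (if j ≤ N then 0 else bbarrc * (1 - ξstar)))) ∧
    (∀ g : ℝ → ℝ, (∀ x y : ℝ, 0 ≤ x → x ≤ y → g x ≤ g y) →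
      ∀ ε ∈ Set.Ioo (0:ℝ) (bbarrc * ξstar),
        ∃ P D : ℕ → ℝ, (∀ k, 0 ≤ P k) ∧ (∀ k, 0 ≤ D k) ∧
          (∀ k : ℕ, 1 ≤ k →
            (∑ j ∈ Finset.Icc 1 k, (qrc (P j) + D j))
              ≤ ∑ j ∈ Finset.Icc 1 (k - 1), Brc j ∧
            (∑ j ∈ Finset.Icc 1 k, qtx (P j))
              ≤ ∑ j ∈ Finset.Icc 1 (k - 1), (Btx j + β * D j)) ∧
          g (qrcinv (bbarrc * ξstar - ε))
            ≤ liminf (fun K => (∑ k ∈ Finset.Icc 1 K, g (P k)) / (K : ℝ)) atTop) := by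
  obtain ⟨hξ0, hξ1⟩ := hξ
  have hd : 0 ≤ bbarrc * (1 - ξstar) := mul_nonneg hbrc.le (by linarith)
  have hctx : 0 < bbartx + β * bbarrc * (1 - ξstar) := by
    have := mul_nonneg hβ.1 hd
    linarith
  have hcrc : 0 < bbarrc * ξstar := mul_pos hbrc hξ0
  have hbal : qrcinv (bbarrc * ξstar) ≤ qtxinv (bbartx + β * bbarrc * (1 - ξstar)) := by
    rcases hξchar with ⟨rfl, h⟩ | ⟨-, h⟩
    · simpa using h
    · exact h.ge
  have hp_nonneg : ∀ ε ∈ Set.Ioo (0:ℝ) (bbarrc * ξstar),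
      0 ≤ qrcinv (bbarrc * ξstar - ε) := fun ε hε =>
    inv_nonneg_of_surjOn hqrc_surj hqrcinv_left (by linarith [hε.2])
  have feasible : ∀ ε ∈ Set.Ioo (0:ℝ) (bbarrc * ξstar), ∃ N : ℕ, 1 ≤ N ∧
      ∀ k : ℕ, 1 ≤ k →
        (∑ j ∈ Finset.Icc 1 k,
            (qrc (if j ≤ N then 0 else qrcinv (bbarrc * ξstar - ε)) +
              (if j ≤ N then 0 else bbarrc * (1 - ξstar))))
          ≤ ∑ j ∈ Finset.Icc 1 (k - 1), Brc j ∧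
        (∑ j ∈ Finset.Icc 1 k, qtx (if j ≤ N then 0 else qrcinv (bbarrc * ξstar - ε)))
          ≤ ∑ j ∈ Finset.Icc 1 (k - 1),
              (Btx j + β * (if j ≤ N then 0 else bbarrc * (1 - ξstar))) := by
    intro ε hε
    have hp := hp_nonneg ε hε
    have hqp : qrc (qrcinv (bbarrc * ξstar - ε)) = bbarrc * ξstar - ε :=
      hqrcinv_right _ (by simpa using hε.2.le)
    have hcrc_inv := inv_nonneg_of_surjOn hqrc_surj hqrcinv_left hcrc.le
    have hlt : qrcinv (bbarrc * ξstar - ε) < qrcinv (bbarrc * ξstar) := by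
      rw [← hqrc_mono.lt_iff_lt hp hcrc_inv, hqp, hqrcinv_right _ hcrc.le]
      linarith [hε.1]
    have ht : qtx (qrcinv (bbarrc * ξstar - ε)) < bbartx + β * (bbarrc * (1 - ξstar)) := by
      have h := hqtx_mono hp (inv_nonneg_of_surjOn hqtx_surj hqtxinv_left hctx.le)
        (hlt.trans_le hbal)
      rwa [hqtxinv_right _ hctx.le, mul_assoc] at h
    obtain ⟨N, hN, hrc, htx⟩ := ((eventually_ge_atTop 1).and
      ((eventually_save_length_receiver hBrc_nonneg hBrc_mean
        (a := bbarrc * ξstar - ε + bbarrc * (1 - ξstar))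
        (by linarith [hε.2]) (by linarith [hε.1])).and
      (eventually_save_length_transmitter hBtx_nonneg hBtx_mean hbtx ht))).exists
    refine ⟨N, hN, fun k _ => ⟨?_, ?_⟩⟩
    · simp only [apply_ite qrc, hqrc0, hqp, Finset.sum_add_distrib, sum_Icc_one_ite_le]
      rw [← mul_add]
      exact hrc k
    · simp only [apply_ite qtx, hqtx0, Finset.sum_add_distrib, ← Finset.mul_sum,
        sum_Icc_one_ite_le]
      rw [mul_left_comm]
      exact htx k
  refine ⟨feasible, fun g _ ε hε => ?_⟩
  obtain ⟨N, -, hN⟩ := feasible ε hε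
  refine ⟨fun j => if j ≤ N then 0 else qrcinv (bbarrc * ξstar - ε),
    fun j => if j ≤ N then 0 else bbarrc * (1 - ξstar), fun k => ?_, fun k => ?_, hN, ?_⟩
  · dsimp only
    split_ifs
    exacts [le_rfl, hp_nonneg ε hε]
  · dsimp only
    split_ifs
    exacts [le_rfl, hd]
  · refine (tendsto_average_of_eventually_const (N := N) fun k hk => ?_).liminf_eq.ge
    simp only [if_neg hk.not_ge]
end
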